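/- arXiv:1606.00121 — 2 statements merged into one kernel-verified Lean document; each statement's English description precedes it below -/
import Mathlib

section
/- The second symmetric discrete derivative (∂_z^1)^2 E of the lattice fundamental solution E belongs to L^1(Z^2). -/
noncomputable section
open Complex MeasureTheory Set
open scoped ENNReal

/-- The scaled square lattice `Z_h^2 ⊂ ℂ`. -/
def latt (h : ℝ) : Set ℂ := {z | ∃ m n : ℤ, z = h * ((m : ℂ) + (n : ℂ) * Complex.I)}

/-- Characteristic function of `B`. -/
def chi (B : Set ℂ) : ℂ → ℝ := B.indicator fun _ => (1 : ℝ)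

/-- Forward difference quotient in direction `1` with step `h`. -/
def dp1 (h : ℝ) (f : ℂ → ℝ) (z : ℂ) : ℝ := (f (z + h) - f z) / h
/-- Backward difference quotient in direction `1` with step `h`. -/
def dm1 (h : ℝ) (f : ℂ → ℝ) (z : ℂ) : ℝ := (f z - f (z - h)) / h
/-- Forward difference quotient in direction `i` with step `h`. -/
def dp2 (h : ℝ) (f : ℂ → ℝ) (z : ℂ) : ℝ := (f (z + h * Complex.I) - f z) / h
/-- Backward difference quotient in direction `i` with step `h`. -/
def dm2 (h : ℝ) (f : ℂ → ℝ) (z : ℂ) : ℝ := (f z - f (z - h * Complex.I)) / h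

/-- `Σ_{i=1,2} (∂_i^{+,h}χ_B)^2 + (∂_i^{-,h}χ_B)^2`. -/
def Qsum (h : ℝ) (B : Set ℂ) (z : ℂ) : ℝ :=
  (dp1 h (chi B) z) ^ 2 + (dm1 h (chi B) z) ^ 2 + (dp2 h (chi B) z) ^ 2 + (dm2 h (chi B) z) ^ 2

/-- Density of the discrete boundary measure. -/
def sden (h : ℝ) (B : Set ℂ) (z : ℂ) : ℝ := (h ^ 2 / 2) * Real.sqrt (Qsum h B z)

/-- Components of the discrete outer normal vector (extended by zero, since `x/0 = 0`). -/
def n1p (h : ℝ) (B : Set ℂ) (z : ℂ) : ℝ := -2 * dp1 h (chi B) z / Real.sqrt (Qsum h B z)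
def n1m (h : ℝ) (B : Set ℂ) (z : ℂ) : ℝ := -2 * dm1 h (chi B) z / Real.sqrt (Qsum h B z)
def n2p (h : ℝ) (B : Set ℂ) (z : ℂ) : ℝ := -2 * dp2 h (chi B) z / Real.sqrt (Qsum h B z)
def n2m (h : ℝ) (B : Set ℂ) (z : ℂ) : ℝ := -2 * dm2 h (chi B) z / Real.sqrt (Qsum h B z)

/-- Five-point neighbourhood `N(z) = {z, z±h, z±hi}`. -/
def nbhd (h : ℝ) (z : ℂ) : Set ℂ := {z, z + h, z - h, z + h * Complex.I, z - h * Complex.I}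

/-- Discrete boundary of `B ⊆ Z_h^2`. -/
def dBdry (h : ℝ) (B : Set ℂ) : Set ℂ :=
  {z ∈ latt h | (nbhd h z ∩ B).Nonempty ∧ (nbhd h z \ B).Nonempty}

/-- Discrete interior. -/
def dInt (h : ℝ) (B : Set ℂ) : Set ℂ := B \ dBdry h B

/-- Discrete closure. -/
def dCl (h : ℝ) (B : Set ℂ) : Set ℂ := B ∪ dBdry h B

/-- Complex forward/backward/symmetric differences, and the discrete ∂̄ and ∂ operators. -/
def cdp1 (h : ℝ) (f : ℂ → ℂ) (z : ℂ) : ℂ := (f (z + h) - f z) / h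
def cdm1 (h : ℝ) (f : ℂ → ℂ) (z : ℂ) : ℂ := (f z - f (z - h)) / h
def cdp2 (h : ℝ) (f : ℂ → ℂ) (z : ℂ) : ℂ := (f (z + h * Complex.I) - f z) / h
def cdm2 (h : ℝ) (f : ℂ → ℂ) (z : ℂ) : ℂ := (f z - f (z - h * Complex.I)) / h

def dbarC (h : ℝ) (f : ℂ → ℂ) (z : ℂ) : ℂ :=
  (1 / 2) * ((1 / 2) * (cdp1 h f z + cdm1 h f z) + Complex.I * ((1 / 2) * (cdp2 h f z + cdm2 h f z)))

def dzC (h : ℝ) (f : ℂ → ℂ) (z : ℂ) : ℂ :=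
  (1 / 2) * ((1 / 2) * (cdp1 h f z + cdm1 h f z) - Complex.I * ((1 / 2) * (cdp2 h f z + cdm2 h f z)))

/-- Symmetric differences on the integer lattice `ℤ²`. -/
def D1 (f : ℤ × ℤ → ℂ) (p : ℤ × ℤ) : ℂ := (f (p.1 + 1, p.2) - f (p.1 - 1, p.2)) / 2
def D2 (f : ℤ × ℤ → ℂ) (p : ℤ × ℤ) : ℂ := (f (p.1, p.2 + 1) - f (p.1, p.2 - 1)) / 2

def dbarZ (f : ℤ × ℤ → ℂ) (p : ℤ × ℤ) : ℂ := (1 / 2) * (D1 f p + Complex.I * D2 f p)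
def dzZ (f : ℤ × ℤ → ℂ) (p : ℤ × ℤ) : ℂ := (1 / 2) * (D1 f p - Complex.I * D2 f p)

/-- The fundamental solution of the discrete ∂̄-operator on `ℤ²`. -/
def Efun (p : ℤ × ℤ) : ℂ :=
  (1 / (4 * Real.pi ^ 2)) •
    ∫ w in (Set.Icc (-Real.pi) Real.pi ×ˢ Set.Icc (-Real.pi) Real.pi),
      (2 / (Complex.I * Real.sin w.1 - Real.sin w.2)) *
        Complex.exp (Complex.I * (w.1 * p.1 + w.2 * p.2))

/-- The rescaled fundamental solution `E^h(z) = (1/h) E(z/h)` on `Z_h^2`. -/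
def Eh (h : ℝ) (z : ℂ) : ℂ := (1 / h : ℂ) * Efun (round (z.re / h), round (z.im / h))

/-- The discrete delta `δ_0^h` on `Z_h^2`. -/
def deltah (h : ℝ) (z : ℂ) : ℂ := if z = 0 then (1 / h ^ 2 : ℂ) else 0

/-- The discrete Bochner-Martinelli kernel. -/
def Kker (h : ℝ) (B : Set ℂ) (z ζ : ℂ) : ℂ :=
  (-(Eh h ((h : ℂ) - (z - ζ))) / 4) * (n1m h B z : ℂ) +
  (-(Eh h (-(h : ℂ) - (z - ζ))) / 4) * (n1p h B z : ℂ) +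
  Complex.I * (-(Eh h ((h : ℂ) * Complex.I - (z - ζ))) / 4) * (n2m h B z : ℂ) +
  Complex.I * (-(Eh h (-((h : ℂ) * Complex.I) - (z - ζ))) / 4) * (n2p h B z : ℂ)

/-- Convergence of lattice sets `B^h` to a bounded open set `B ⊂ ℂ`. -/
def ConvergesTo (Bh : ℝ → Set ℂ) (B : Set ℂ) : Prop :=
  ∀ ε > 0, ∃ δ > 0, ∀ h : ℝ, 0 < h → h < δ →
    (∀ α ∈ frontier B, ∃ β ∈ dBdry h (Bh h), dist α β < ε) ∧
    (∀ α ∈ dBdry h (Bh h), ∃ β ∈ frontier B, dist α β < ε) ∧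
    (∀ α ∈ closure B, ∃ β ∈ Bh h, dist α β < ε) ∧
    (∀ α ∈ Bh h, ∃ β ∈ closure B, dist α β < ε)

/-- The function `1 / √(1 + sin² u)`. -/
def invRoot (u : ℝ) : ℝ := (√(1 + Real.sin u ^ 2))⁻¹

/-- The root of modulus less than one of `1 / r - r = 2 sin u`, for `0 < sin u`. -/
def decayRoot (u : ℝ) : ℝ := √(1 + Real.sin u ^ 2) - Real.sin u

lemma sqrt_one_add_sq_pos (s : ℝ) : 0 < √(1 + s ^ 2) := Real.sqrt_pos.2 (by positivity)

lemma continuous_invRoot : Continuous invRoot := by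
  unfold invRoot
  exact Continuous.inv₀ (by fun_prop) fun u => (sqrt_one_add_sq_pos _).ne'

lemma continuous_decayRoot : Continuous decayRoot := by
  unfold decayRoot
  fun_prop

lemma invRoot_nonneg (u : ℝ) : 0 ≤ invRoot u := inv_nonneg.2 (Real.sqrt_nonneg _)

lemma invRoot_le_one (u : ℝ) : invRoot u ≤ 1 :=
  inv_le_one_of_one_le₀ (Real.one_le_sqrt.2 (by nlinarith [sq_nonneg (Real.sin u)]))

lemma decayRoot_pos (u : ℝ) : 0 < decayRoot u :=
  sub_pos.2 (Real.lt_sqrt_of_sq_lt (by linarith))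

lemma hasDerivAt_sqrt_one_add_sin_sq (u : ℝ) :
    HasDerivAt (fun u => √(1 + Real.sin u ^ 2)) (Real.sin u * Real.cos u * invRoot u) u := by
  have hpos : 1 + Real.sin u ^ 2 ≠ 0 := by positivity
  refine ((((Real.hasDerivAt_sin u).pow 2).const_add 1).sqrt hpos).congr_deriv ?_
  have := (sqrt_one_add_sq_pos (Real.sin u)).ne'
  simp only [invRoot, Pi.pow_apply]
  field_simp
  push_cast
  ring

lemma hasDerivAt_invRoot (u : ℝ) :
    HasDerivAt invRoot (-(Real.sin u * Real.cos u * invRoot u ^ 3)) u := by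
  have h := (hasDerivAt_sqrt_one_add_sin_sq u).inv (sqrt_one_add_sq_pos _).ne'
  refine h.congr_deriv ?_
  simp only [invRoot]
  field_simp

lemma hasDerivAt_decayRoot_pow (n : ℕ) (u : ℝ) :
    HasDerivAt (fun u => decayRoot u ^ n) (-(n * Real.cos u * invRoot u * decayRoot u ^ n)) u := by
  have h : HasDerivAt decayRoot (-(Real.cos u * invRoot u * decayRoot u)) u := by
    refine ((hasDerivAt_sqrt_one_add_sin_sq u).sub (Real.hasDerivAt_sin u)).congr_deriv ?_
    have := (sqrt_one_add_sq_pos (Real.sin u)).ne'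
    simp only [invRoot, decayRoot]
    field_simp
    ring
  refine (h.pow n).congr_deriv ?_
  rcases n with _ | n
  · simp
  · simp only [Nat.add_sub_cancel]
    ring

lemma decayRoot_pow_le {u : ℝ} (hu : 0 ≤ Real.sin u) (n : ℕ) :
    decayRoot u ^ n ≤ Real.exp (-(n * Real.sin u / 2)) := by
  have h1 : decayRoot u ≤ Real.exp (-(Real.sin u / 2)) := by
    have hs := Real.sin_le_one u
    have he : Real.exp (Real.sin u / 2) ≤ 1 + Real.sin u := by
      have := Real.abs_exp_sub_one_sub_id_le (x := Real.sin u / 2)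
        (by rw [abs_of_nonneg] <;> linarith)
      nlinarith [(abs_le.1 this).2]
    have h2 : decayRoot u * (√(1 + Real.sin u ^ 2) + Real.sin u) = 1 := by
      have := Real.sq_sqrt (show 0 ≤ 1 + Real.sin u ^ 2 by positivity)
      unfold decayRoot
      nlinarith
    have h3 : 1 ≤ √(1 + Real.sin u ^ 2) :=
      Real.one_le_sqrt.2 (by nlinarith [sq_nonneg (Real.sin u)])
    rw [Real.exp_neg, ← one_div, le_div_iff₀ (Real.exp_pos _)]
    nlinarith [decayRoot_pos u]
  calc decayRoot u ^ n ≤ Real.exp (-(Real.sin u / 2)) ^ n :=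
        pow_le_pow_left₀ (decayRoot_pos u).le h1 n
    _ = _ := by rw [← Real.exp_nat_mul]; ring_nf

/-- The profile `sin² u · r(u)ⁿ / √(1 + sin² u)` that arises from integrating
`sin² u / (i sin u - sin v)` against a character in `v`. -/
def profile (n : ℕ) (u : ℝ) : ℝ := Real.sin u ^ 2 * invRoot u * decayRoot u ^ n

/-- The first derivative of `profile`. -/
def profileDeriv (n : ℕ) (u : ℝ) : ℝ :=
  (2 * Real.sin u * Real.cos u * invRoot u - Real.sin u ^ 3 * Real.cos u * invRoot u ^ 3
    - n * Real.sin u ^ 2 * Real.cos u * invRoot u ^ 2) * decayRoot u ^ n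

/-- The second derivative of `profile`. -/
def profileDerivTwo (n : ℕ) (u : ℝ) : ℝ :=
  ((2 * (Real.cos u ^ 2 - Real.sin u ^ 2) * invRoot u
      - 5 * Real.sin u ^ 2 * Real.cos u ^ 2 * invRoot u ^ 3 + Real.sin u ^ 4 * invRoot u ^ 3
      + 3 * Real.sin u ^ 4 * Real.cos u ^ 2 * invRoot u ^ 5)
    - n * Real.sin u * (4 * Real.cos u ^ 2 * invRoot u ^ 2 - Real.sin u ^ 2 * invRoot u ^ 2
      - 3 * Real.sin u ^ 2 * Real.cos u ^ 2 * invRoot u ^ 4)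
    + (n * Real.sin u) ^ 2 * (Real.cos u ^ 2 * invRoot u ^ 3)) * decayRoot u ^ n

lemma hasDerivAt_profile (n : ℕ) (u : ℝ) : HasDerivAt (profile n) (profileDeriv n u) u := by
  refine ((((Real.hasDerivAt_sin u).pow 2).mul (hasDerivAt_invRoot u)).mul
    (hasDerivAt_decayRoot_pow n u)).congr_deriv ?_
  simp only [profileDeriv, Pi.mul_apply, Pi.pow_apply]
  push_cast
  ring

lemma hasDerivAt_profileDeriv (n : ℕ) (u : ℝ) :
    HasDerivAt (profileDeriv n) (profileDerivTwo n u) u := by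
  have hs := Real.hasDerivAt_sin u
  have hc := Real.hasDerivAt_cos u
  have ha := hasDerivAt_invRoot u
  have h1 := ((hs.const_mul 2).mul hc).mul ha
  have h2 := ((hs.pow 3).mul hc).mul (ha.pow 3)
  have h3 := (((hs.pow 2).const_mul (n : ℝ)).mul hc).mul (ha.pow 2)
  refine (((h1.sub h2).sub h3).mul (hasDerivAt_decayRoot_pow n u)).congr_deriv ?_
  simp only [profileDerivTwo, Pi.mul_apply, Pi.pow_apply, Pi.sub_apply]
  push_cast
  ring

lemma continuous_profile (n : ℕ) : Continuous (profile n) :=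
  continuous_iff_continuousAt.2 fun u => (hasDerivAt_profile n u).continuousAt

lemma continuous_profileDerivTwo (n : ℕ) : Continuous (profileDerivTwo n) := by
  have := continuous_invRoot
  have := continuous_decayRoot
  unfold profileDerivTwo
  fun_prop

lemma exists_abs_profileDerivTwo_le :
    ∃ C, ∀ n : ℕ, ∀ u ∈ Icc 0 Real.pi, |profileDerivTwo n u| ≤ C := by
  have hA := continuous_invRoot
  obtain ⟨C₀, h0⟩ := (isCompact_Icc (a := 0) (b := Real.pi)).exists_bound_of_continuousOn
    (f := fun u => 2 * (Real.cos u ^ 2 - Real.sin u ^ 2) * invRoot u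
      - 5 * Real.sin u ^ 2 * Real.cos u ^ 2 * invRoot u ^ 3 + Real.sin u ^ 4 * invRoot u ^ 3
      + 3 * Real.sin u ^ 4 * Real.cos u ^ 2 * invRoot u ^ 5) (by fun_prop)
  obtain ⟨C₁, h1⟩ := (isCompact_Icc (a := 0) (b := Real.pi)).exists_bound_of_continuousOn
    (f := fun u => 4 * Real.cos u ^ 2 * invRoot u ^ 2 - Real.sin u ^ 2 * invRoot u ^ 2
      - 3 * Real.sin u ^ 2 * Real.cos u ^ 2 * invRoot u ^ 4) (by fun_prop)
  obtain ⟨C₂, h2⟩ := (isCompact_Icc (a := 0) (b := Real.pi)).exists_bound_of_continuousOn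
    (f := fun u => Real.cos u ^ 2 * invRoot u ^ 3) (by fun_prop)
  refine ⟨C₀ + 2 * C₁ + 8 * C₂, fun n u hu => ?_⟩
  have hs := Real.sin_nonneg_of_mem_Icc hu
  replace h0 := h0 u hu
  replace h1 := h1 u hu
  replace h2 := h2 u hu
  simp only [Real.norm_eq_abs] at h0 h1 h2
  have hr := decayRoot_pow_le hs n
  have hr0 : 0 ≤ decayRoot u ^ n := pow_nonneg (decayRoot_pos u).le n
  have ht : 0 ≤ n * Real.sin u := by positivity
  have hq := Real.quadratic_le_exp_of_nonneg (x := n * Real.sin u / 2) (by positivity)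
  rw [Real.exp_neg] at hr
  unfold profileDerivTwo
  generalize (n : ℝ) * Real.sin u = t at *
  generalize decayRoot u ^ n = r at *
  have hE : r * Real.exp (t / 2) ≤ 1 := by
    rwa [← one_div, le_div_iff₀ (Real.exp_pos _)] at hr
  have hrq : r * (1 + t / 2 + (t / 2) ^ 2 / 2) ≤ 1 :=
    (mul_le_mul_of_nonneg_left hq hr0).trans hE
  have hrt := mul_nonneg hr0 ht
  have hrtt := mul_nonneg hrt ht
  rw [abs_mul, abs_of_nonneg hr0]
  calc _ ≤ (C₀ + t * C₁ + t ^ 2 * C₂) * r := by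
        refine mul_le_mul_of_nonneg_right ((abs_add_le _ _).trans (add_le_add ((abs_sub _ _).trans
          (add_le_add h0 ?_)) ?_)) hr0
        · rw [abs_mul, abs_of_nonneg ht]; gcongr
        · rw [abs_mul, abs_of_nonneg (sq_nonneg t)]; gcongr
    _ = C₀ * r + C₁ * (r * t) + C₂ * (r * t * t) := by ring
    _ ≤ C₀ * 1 + C₁ * 2 + C₂ * 8 := by
        have := (abs_nonneg _).trans h0
        have := (abs_nonneg _).trans h1
        have := (abs_nonneg _).trans h2
        gcongr <;> nlinarith
    _ = _ := by ring

/-- The Fourier coefficients over `[0, π]` of `profile`. -/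
def profileCoeff (n : ℕ) (x : ℤ) : ℂ :=
  ∫ u in (0 : ℝ)..Real.pi, (profile n u : ℂ) * Complex.exp (I * (u * x))

lemma norm_exp_I_mul_ofReal_mul_int (u : ℝ) (x : ℤ) : ‖Complex.exp (I * (u * x))‖ = 1 := by
  exact_mod_cast Complex.norm_exp_I_mul_ofReal (u * x)

lemma sq_mul_profileCoeff (n : ℕ) (x : ℤ) :
    (x : ℂ) ^ 2 * profileCoeff n x =
      -∫ u in (0 : ℝ)..Real.pi, (profileDerivTwo n u : ℂ) * Complex.exp (I * (u * x)) := by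
  have hcF := continuous_profile n
  have hcF2 := continuous_profileDerivTwo n
  have hd (u : ℝ) : HasDerivAt (fun u : ℝ =>
      ((profileDeriv n u : ℂ) - I * x * profile n u) * Complex.exp (I * (u * x)))
      ((x : ℂ) ^ 2 * (profile n u * Complex.exp (I * (u * x)))
        + profileDerivTwo n u * Complex.exp (I * (u * x))) u := by
    have he : HasDerivAt (fun u : ℝ => Complex.exp (I * (u * x)))
        (Complex.exp (I * (u * x)) * (I * (1 * x))) u :=
      ((((hasDerivAt_id u).ofReal_comp).mul_const (x : ℂ)).const_mul I).cexp
    refine (((hasDerivAt_profileDeriv n u).ofReal_comp.sub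
      ((hasDerivAt_profile n u).ofReal_comp.const_mul (I * x))).mul he).congr_deriv ?_
    simp only [Pi.sub_apply]
    linear_combination (-(x : ℂ) ^ 2 * profile n u * Complex.exp (I * (u * x))) * I_sq
  have hint := intervalIntegral.integral_eq_sub_of_hasDerivAt (a := 0) (b := Real.pi)
    (fun u _ => hd u) (Continuous.intervalIntegrable (by fun_prop) _ _)
  rw [intervalIntegral.integral_add (Continuous.intervalIntegrable (by fun_prop) _ _)
    (Continuous.intervalIntegrable (by fun_prop) _ _),
    intervalIntegral.integral_const_mul] at hint
  have h0 : profile n 0 = 0 ∧ profile n Real.pi = 0 ∧ profileDeriv n 0 = 0 ∧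
    profileDeriv n Real.pi = 0 := by simp [profile, profileDeriv]
  rw [h0.1, h0.2.1, h0.2.2.1, h0.2.2.2, Complex.ofReal_zero] at hint
  rw [profileCoeff]
  linear_combination hint

lemma integral_exp_neg_mul_le {c : ℝ} (hc : 0 < c) :
    ∫ u in (0 : ℝ)..Real.pi, Real.exp (-(c * u)) ≤ 1 / c := by
  have hd (u : ℝ) : HasDerivAt (fun u => -Real.exp (-(c * u)) / c) (Real.exp (-(c * u))) u := by
    refine (((hasDerivAt_id u).const_mul c).neg.exp.neg.div_const c).congr_deriv ?_
    simp
    field_simp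
  rw [intervalIntegral.integral_eq_sub_of_hasDerivAt (fun u _ => hd u)
    (Continuous.intervalIntegrable (by fun_prop) _ _)]
  have := Real.exp_pos (-(c * Real.pi))
  have h : -Real.exp (-(c * Real.pi)) / c ≤ 0 :=
    div_nonpos_of_nonpos_of_nonneg (by linarith) hc.le
  simp only [mul_zero, neg_zero, Real.exp_zero, neg_div, sub_neg_eq_add] at h ⊢
  linarith

lemma exp_neg_mul_sin_le {c : ℝ} (hc : 0 ≤ c) {u : ℝ} (hu : u ∈ Icc 0 Real.pi) :
    Real.exp (-(c * Real.sin u)) ≤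
      Real.exp (-(c * (2 / Real.pi) * u)) + Real.exp (-(c * (2 / Real.pi) * (Real.pi - u))) := by
  have h1 := Real.exp_pos (-(c * (2 / Real.pi) * u))
  have h2 := Real.exp_pos (-(c * (2 / Real.pi) * (Real.pi - u)))
  rcases le_total u (Real.pi / 2) with h | h
  · have := mul_le_mul_of_nonneg_left (Real.mul_le_sin hu.1 h) hc
    have := Real.exp_le_exp.2 (show -(c * Real.sin u) ≤ -(c * (2 / Real.pi) * u) by linarith)
    linarith
  · have h3 := Real.mul_le_sin (x := Real.pi - u) (by linarith [hu.2]) (by linarith)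
    rw [Real.sin_pi_sub] at h3
    have := mul_le_mul_of_nonneg_left h3 hc
    have := Real.exp_le_exp.2
      (show -(c * Real.sin u) ≤ -(c * (2 / Real.pi) * (Real.pi - u)) by linarith)
    linarith

lemma integral_exp_neg_mul_sin_le {c : ℝ} (hc : 0 < c) :
    ∫ u in (0 : ℝ)..Real.pi, Real.exp (-(c * Real.sin u)) ≤ Real.pi / c := by
  have hp := Real.pi_pos
  have hk : 0 < c * (2 / Real.pi) := by positivity
  calc _ ≤ ∫ u in (0 : ℝ)..Real.pi, (Real.exp (-(c * (2 / Real.pi) * u)) +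
          Real.exp (-(c * (2 / Real.pi) * (Real.pi - u)))) :=
        intervalIntegral.integral_mono_on hp.le (Continuous.intervalIntegrable (by fun_prop) _ _)
          (Continuous.intervalIntegrable (by fun_prop) _ _)
          fun u hu => exp_neg_mul_sin_le hc.le hu
    _ = (∫ u in (0 : ℝ)..Real.pi, Real.exp (-(c * (2 / Real.pi) * u))) +
          ∫ u in (0 : ℝ)..Real.pi, Real.exp (-(c * (2 / Real.pi) * u)) := by
        rw [intervalIntegral.integral_add (Continuous.intervalIntegrable (by fun_prop) _ _)
          (Continuous.intervalIntegrable (by fun_prop) _ _),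
          intervalIntegral.integral_comp_sub_left
            (fun u => Real.exp (-(c * (2 / Real.pi) * u))) Real.pi]
        simp
    _ ≤ 1 / (c * (2 / Real.pi)) + 1 / (c * (2 / Real.pi)) :=
        add_le_add (integral_exp_neg_mul_le hk) (integral_exp_neg_mul_le hk)
    _ = Real.pi / c := by field_simp; norm_num

lemma abs_profile (n : ℕ) (u : ℝ) : |profile n u| = profile n u :=
  abs_of_nonneg (mul_nonneg (mul_nonneg (sq_nonneg _) (invRoot_nonneg u))
    (pow_nonneg (decayRoot_pos u).le n))

lemma profile_le {u : ℝ} (hu : 0 ≤ Real.sin u) (n : ℕ) :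
    profile n u ≤ Real.sin u ^ 2 * Real.exp (-(n * Real.sin u / 2)) := by
  unfold profile
  refine mul_le_mul ?_ (decayRoot_pow_le hu n) (pow_nonneg (decayRoot_pos u).le n) (sq_nonneg _)
  exact mul_le_of_le_one_right (sq_nonneg _) (invRoot_le_one u)

lemma profile_le_one {u : ℝ} (hu : 0 ≤ Real.sin u) (n : ℕ) : profile n u ≤ 1 := by
  refine (profile_le hu n).trans (mul_le_one₀ (Real.sin_sq_le_one u) (Real.exp_pos _).le ?_)
  exact Real.exp_le_one_iff.2 (neg_nonpos.2 (by positivity))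

lemma norm_profileCoeff_le_pi (n : ℕ) (x : ℤ) : ‖profileCoeff n x‖ ≤ Real.pi := by
  have := intervalIntegral.norm_integral_le_of_norm_le_const (a := 0) (b := Real.pi) (C := 1)
    (f := fun u : ℝ => (profile n u : ℂ) * Complex.exp (I * (u * x))) fun u hu => by
      rw [uIoc_of_le Real.pi_pos.le] at hu
      rw [norm_mul, norm_exp_I_mul_ofReal_mul_int, mul_one, Complex.norm_real, Real.norm_eq_abs,
        abs_profile]
      exact profile_le_one (Real.sin_nonneg_of_mem_Icc ⟨hu.1.le, hu.2⟩) n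
  simpa [abs_of_pos Real.pi_pos, profileCoeff] using this

lemma norm_profileCoeff_le_integral (n : ℕ) (x : ℤ) :
    ‖profileCoeff n x‖ ≤ ∫ u in (0 : ℝ)..Real.pi, profile n u := by
  refine (intervalIntegral.norm_integral_le_integral_norm Real.pi_pos.le).trans_eq ?_
  simp only [norm_mul, norm_exp_I_mul_ofReal_mul_int, mul_one, Complex.norm_real,
    Real.norm_eq_abs, abs_profile]

lemma cube_mul_norm_profileCoeff_le (n : ℕ) (x : ℤ) :
    (n : ℝ) ^ 3 * ‖profileCoeff n x‖ ≤ 128 * Real.pi := by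
  rcases Nat.eq_zero_or_pos n with rfl | hn
  · have := Real.pi_pos
    simp
    positivity
  have hn' : (0 : ℝ) < n := by exact_mod_cast hn
  have hle : ∫ u in (0 : ℝ)..Real.pi, profile n u ≤
      ∫ u in (0 : ℝ)..Real.pi, 32 / (n : ℝ) ^ 2 * Real.exp (-(n / 4 * Real.sin u)) := by
    refine intervalIntegral.integral_mono_on Real.pi_pos.le
      ((continuous_profile n).intervalIntegrable _ _)
      (Continuous.intervalIntegrable (by fun_prop) _ _) fun u hu => ?_
    have hs := Real.sin_nonneg_of_mem_Icc hu
    refine (profile_le hs n).trans ?_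
    have hq := Real.quadratic_le_exp_of_nonneg (x := n / 4 * Real.sin u) (by positivity)
    have he : Real.exp (-(n * Real.sin u / 2)) =
        Real.exp (-(n / 4 * Real.sin u)) * Real.exp (-(n / 4 * Real.sin u)) := by
      rw [← Real.exp_add]; ring_nf
    have h1 : Real.exp (-(n / 4 * Real.sin u)) * Real.exp (n / 4 * Real.sin u) = 1 := by
      rw [← Real.exp_add]; simp
    have h2 := Real.exp_pos (-(n / 4 * Real.sin u))
    have h3 : 0 ≤ n / 4 * Real.sin u := by positivity
    have h4 : Real.sin u ^ 2 * Real.exp (-(n / 4 * Real.sin u)) ≤ 32 / (n : ℝ) ^ 2 := by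
      rw [le_div_iff₀ (by positivity)]
      have := mul_le_mul_of_nonneg_left
        (show (n / 4 * Real.sin u) ^ 2 / 2 ≤ Real.exp (n / 4 * Real.sin u) by linarith) h2.le
      nlinarith
    rw [he, ← mul_assoc]
    exact mul_le_mul_of_nonneg_right h4 h2.le
  have hI := integral_exp_neg_mul_sin_le (c := n / 4) (by positivity)
  rw [intervalIntegral.integral_const_mul] at hle
  calc (n : ℝ) ^ 3 * ‖profileCoeff n x‖
      ≤ (n : ℝ) ^ 3 * (32 / (n : ℝ) ^ 2 * (Real.pi / (n / 4))) := by
        refine mul_le_mul_of_nonneg_left ?_ (by positivity)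
        refine (norm_profileCoeff_le_integral n x).trans (hle.trans ?_)
        gcongr
    _ = 128 * Real.pi := by field_simp; norm_num

lemma exists_sq_mul_norm_profileCoeff_le :
    ∃ C, ∀ (n : ℕ) (x : ℤ), (x : ℝ) ^ 2 * ‖profileCoeff n x‖ ≤ C := by
  obtain ⟨C, hC⟩ := exists_abs_profileDerivTwo_le
  refine ⟨C * |Real.pi - 0|, fun n x => ?_⟩
  have h : ‖(x : ℂ) ^ 2 * profileCoeff n x‖ = (x : ℝ) ^ 2 * ‖profileCoeff n x‖ := by
    simp
  rw [← h, sq_mul_profileCoeff, norm_neg]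
  refine intervalIntegral.norm_integral_le_of_norm_le_const fun u hu => ?_
  rw [uIoc_of_le Real.pi_pos.le] at hu
  rw [norm_mul, norm_exp_I_mul_ofReal_mul_int, mul_one, Complex.norm_real, Real.norm_eq_abs]
  exact hC n u ⟨hu.1.le, hu.2⟩

lemma le_mul_rpow_of_sq_mul_le_of_cube_mul_le {X N b C : ℝ} (hX : 0 < X) (hN : 0 < N)
    (hb : 0 ≤ b) (hXb : X ^ 2 * b ≤ C) (hNb : N ^ 3 * b ≤ C) :
    b ≤ C * (X ^ (-(6 / 5) : ℝ) * N ^ (-(6 / 5) : ℝ)) := by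
  have hC : 0 ≤ C := le_trans (by positivity) hXb
  rcases hb.eq_or_lt with rfl | hb'
  · positivity
  have hC' : 0 < C := lt_of_lt_of_le (by positivity) hXb
  have h1 : b ≤ C * X ^ (-2 : ℝ) := by
    rw [Real.rpow_neg hX.le, ← div_eq_mul_inv, le_div_iff₀ (by positivity)]
    norm_cast
    linarith
  have h2 : b ≤ C * N ^ (-3 : ℝ) := by
    rw [Real.rpow_neg hN.le, ← div_eq_mul_inv, le_div_iff₀ (by positivity)]
    norm_cast
    linarith
  calc b = b ^ (3 / 5 : ℝ) * b ^ (2 / 5 : ℝ) := by rw [← Real.rpow_add hb']; norm_num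
    _ ≤ (C * X ^ (-2 : ℝ)) ^ (3 / 5 : ℝ) * (C * N ^ (-3 : ℝ)) ^ (2 / 5 : ℝ) := by gcongr
    _ = (C ^ (3 / 5 : ℝ) * C ^ (2 / 5 : ℝ)) * (X ^ (-(6 / 5) : ℝ) * N ^ (-(6 / 5) : ℝ)) := by
        rw [Real.mul_rpow hC (by positivity), Real.mul_rpow hC (by positivity),
          ← Real.rpow_mul hX.le, ← Real.rpow_mul hN.le]
        norm_num
        ring
    _ = _ := by rw [← Real.rpow_add hC']; norm_num

lemma exists_norm_profileCoeff_le :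
    ∃ C, ∀ (n : ℕ) (x : ℤ), ‖profileCoeff n x‖ ≤
      C * ((1 + |(x : ℝ)|) ^ (-(6 / 5) : ℝ) * (1 + (n : ℝ)) ^ (-(6 / 5) : ℝ)) := by
  obtain ⟨C, hC⟩ := exists_sq_mul_norm_profileCoeff_le
  refine ⟨max (2 * C + 2 * Real.pi) (4 * (128 * Real.pi) + 4 * Real.pi), fun n x =>
    le_mul_rpow_of_sq_mul_le_of_cube_mul_le (by positivity) (by positivity) (norm_nonneg _)
      (le_max_of_le_left ?_) (le_max_of_le_right ?_)⟩
  · have h1 := norm_profileCoeff_le_pi n x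
    have h2 := hC n x
    have h3 : (1 + |(x : ℝ)|) ^ 2 ≤ 2 + 2 * (x : ℝ) ^ 2 := by
      nlinarith [sq_nonneg (1 - |(x : ℝ)|), sq_abs (x : ℝ)]
    nlinarith [mul_le_mul_of_nonneg_right h3 (norm_nonneg (profileCoeff n x))]
  · have h1 := norm_profileCoeff_le_pi n x
    have h2 := cube_mul_norm_profileCoeff_le n x
    have hn : (0 : ℝ) ≤ n := n.cast_nonneg
    have h3 : (1 + (n : ℝ)) ^ 3 ≤ 4 + 4 * (n : ℝ) ^ 3 := by
      nlinarith [mul_nonneg (add_nonneg zero_le_one hn) (sq_nonneg (1 - (n : ℝ)))]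
    nlinarith [mul_le_mul_of_nonneg_right h3 (norm_nonneg (profileCoeff n x))]

lemma summable_one_add_abs_int_rpow :
    Summable fun n : ℤ => (1 + |(n : ℝ)|) ^ (-(6 / 5) : ℝ) := by
  refine ((Real.summable_one_div_int_add_rpow (1 / 2) (6 / 5)).2 (by norm_num)).of_nonneg_of_le
    (fun n => by positivity) fun n => ?_
  have hne : (n : ℝ) + 1 / 2 ≠ 0 := by
    intro h
    have h2 : ((2 * n + 1 : ℤ) : ℝ) = 0 := by push_cast; linarith
    have h3 : 2 * n + 1 = 0 := by exact_mod_cast h2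
    omega
  rw [Real.rpow_neg (by positivity), one_div]
  have hpos := abs_pos.2 hne
  refine inv_anti₀ (by positivity) (Real.rpow_le_rpow (abs_nonneg _) ?_ (by norm_num))
  refine (abs_add_le _ _).trans ?_
  rw [abs_of_pos (by norm_num : (0 : ℝ) < 1 / 2)]
  linarith

lemma summable_norm_profileCoeff :
    Summable fun p : ℤ × ℤ => ‖profileCoeff p.2.natAbs p.1‖ := by
  obtain ⟨C, hC⟩ := exists_norm_profileCoeff_le
  refine ((summable_one_add_abs_int_rpow.mul_of_nonneg summable_one_add_abs_int_rpow
    (fun _ => by positivity) fun _ => by positivity).mul_left C).of_nonneg_of_le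
    (fun _ => norm_nonneg _) fun p => ?_
  have h := hC p.2.natAbs p.1
  rwa [Nat.cast_natAbs, Int.cast_abs] at h

lemma integral_exp_I_mul_int (k : ℤ) :
    ∫ v in (-Real.pi)..Real.pi, Complex.exp (I * (v * k)) =
      if k = 0 then 2 * (Real.pi : ℂ) else 0 := by
  split_ifs with hk
  · simp [hk]
    ring
  · have hk' : I * (k : ℂ) ≠ 0 := mul_ne_zero I_ne_zero (Int.cast_ne_zero.2 hk)
    have h1 : (fun v : ℝ => Complex.exp (I * (v * k))) = fun v : ℝ => Complex.exp (I * k * v) := by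
      funext v; ring_nf
    have h2 : Complex.exp (I * k * (Real.pi : ℝ)) = Complex.exp (I * k * (-Real.pi : ℝ)) :=
      Complex.exp_eq_exp_iff_exists_int.2 ⟨k, by push_cast; ring⟩
    rw [h1, integral_exp_mul_complex hk', h2, sub_self, zero_div]

lemma integral_exp_mul_inv_one_sub {ρ : ℝ} (hρ : |ρ| < 1) (y : ℤ) :
    ∫ v in (-Real.pi)..Real.pi, Complex.exp (I * (v * y)) * (1 - ρ * Complex.exp (-(I * v)))⁻¹ =
      if 0 ≤ y then 2 * Real.pi * (ρ : ℂ) ^ y.natAbs else 0 := by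
  have hterm (k : ℕ) (v : ℝ) : (ρ : ℂ) ^ k * Complex.exp (I * (v * (y - k : ℤ))) =
      Complex.exp (I * (v * y)) * (ρ * Complex.exp (-(I * v))) ^ k := by
    rw [mul_pow, ← Complex.exp_nat_mul, mul_left_comm (Complex.exp _), ← Complex.exp_add]
    push_cast
    ring_nf
  have hsum : HasSum
      (fun k : ℕ => ∫ v in (-Real.pi)..Real.pi, (ρ : ℂ) ^ k * Complex.exp (I * (v * (y - k : ℤ))))
      (∫ v in (-Real.pi)..Real.pi,
        Complex.exp (I * (v * y)) * (1 - ρ * Complex.exp (-(I * v)))⁻¹) := by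
    refine intervalIntegral.hasSum_integral_of_dominated_convergence (fun k _ => |ρ| ^ k)
      (fun k => Continuous.aestronglyMeasurable (by fun_prop))
      (fun k => .of_forall fun v _ => ?_)
      (.of_forall fun v _ => summable_geometric_of_lt_one (abs_nonneg ρ) hρ)
      (continuous_const.intervalIntegrable _ _) (.of_forall fun v _ => ?_)
    · rw [norm_mul, norm_exp_I_mul_ofReal_mul_int, norm_pow, Complex.norm_real, mul_one,
        Real.norm_eq_abs]
    · have hnorm : ‖(ρ : ℂ) * Complex.exp (-(I * v))‖ < 1 := by
        rw [norm_mul, ← mul_neg, ← Complex.ofReal_neg, Complex.norm_exp_I_mul_ofReal,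
          Complex.norm_real, mul_one]
        exact hρ
      have hgeom := (hasSum_geometric_of_norm_lt_one hnorm).mul_left (Complex.exp (I * (v * y)))
      simpa only [hterm] using hgeom
  refine hsum.unique ?_
  simp only [intervalIntegral.integral_const_mul, integral_exp_I_mul_int]
  split_ifs with hy
  · convert hasSum_single y.natAbs fun k hk => ?_ using 1
    · rw [if_pos (by omega)]
      ring
    · rw [if_neg (by omega), mul_zero]
  · convert hasSum_zero using 2 with k
    rw [if_neg (by omega), mul_zero]

lemma integral_exp_mul_inv_one_add {ρ : ℝ} (hρ : |ρ| < 1) (y : ℤ) :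
    ∫ v in (-Real.pi)..Real.pi, Complex.exp (I * (v * y)) * (1 + ρ * Complex.exp (I * v))⁻¹ =
      if y ≤ 0 then 2 * Real.pi * (-ρ : ℂ) ^ y.natAbs else 0 := by
  have h := integral_exp_mul_inv_one_sub (ρ := -ρ) (by rwa [abs_neg]) (-y)
  have h2 := intervalIntegral.integral_comp_neg (a := -Real.pi) (b := Real.pi)
    (fun v : ℝ => Complex.exp (I * (v * y)) * (1 + ρ * Complex.exp (I * v))⁻¹)
  rw [neg_neg] at h2
  rw [← h2]
  simpa using h

lemma one_sub_mul_exp_ne_zero {ρ : ℝ} (hρ : |ρ| < 1) (v : ℝ) :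
    1 - (ρ : ℂ) * Complex.exp (I * v) ≠ 0 := by
  intro h
  have h1 : ‖(ρ : ℂ) * Complex.exp (I * v)‖ = 1 := by rw [← sub_eq_zero.1 h, norm_one]
  rw [norm_mul, Complex.norm_exp_I_mul_ofReal, mul_one, Complex.norm_real, Real.norm_eq_abs] at h1
  exact hρ.ne h1

lemma decayRoot_lt_one {u : ℝ} (hu : 0 < Real.sin u) : decayRoot u < 1 := by
  have h : √(1 + Real.sin u ^ 2) < 1 + Real.sin u :=
    (Real.sqrt_lt' (by linarith)).2 (by nlinarith)
  unfold decayRoot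
  linarith

lemma two_div_eq_partial_fractions {u : ℝ} (hu : 0 < Real.sin u) (v : ℝ) :
    2 / (I * Real.sin u - Real.sin v) = -2 * I * invRoot u *
      ((1 - decayRoot u * Complex.exp (-(I * v)))⁻¹
        + (1 + decayRoot u * Complex.exp (I * v))⁻¹ - 1) := by
  have hr : |decayRoot u| < 1 := by rw [abs_of_pos (decayRoot_pos u)]; exact decayRoot_lt_one hu
  have hr0 : (decayRoot u : ℂ) ≠ 0 := Complex.ofReal_ne_zero.2 (decayRoot_pos u).ne'
  have hP : 1 - (decayRoot u : ℂ) * Complex.exp (-(I * v)) ≠ 0 := by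
    simpa using one_sub_mul_exp_ne_zero hr (-v)
  have hQ : 1 + (decayRoot u : ℂ) * Complex.exp (I * v) ≠ 0 := by
    simpa using one_sub_mul_exp_ne_zero (ρ := -decayRoot u) (by rwa [abs_neg]) v
  have hzw : Complex.exp (I * v) * Complex.exp (-(I * v)) = 1 := by
    rw [← Complex.exp_add, add_neg_cancel, Complex.exp_zero]
  have hsin : (Real.sin v : ℂ) = (Complex.exp (-(I * v)) - Complex.exp (I * v)) * I / 2 := by
    rw [Complex.ofReal_sin, Complex.sin, neg_mul, mul_comm (v : ℂ) I]
  have hr2 : (decayRoot u : ℂ) ^ 2 + 2 * Real.sin u * decayRoot u = 1 := by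
    have : decayRoot u ^ 2 + 2 * Real.sin u * decayRoot u = 1 := by
      have := Real.sq_sqrt (show 0 ≤ 1 + Real.sin u ^ 2 by positivity)
      unfold decayRoot
      nlinarith
    exact_mod_cast this
  have hA : (invRoot u : ℂ) * (1 + (decayRoot u : ℂ) ^ 2) = 2 * decayRoot u := by
    have : invRoot u * (1 + decayRoot u ^ 2) = 2 * decayRoot u := by
      have h1 := Real.sq_sqrt (show 0 ≤ 1 + Real.sin u ^ 2 by positivity)
      have h2 := (sqrt_one_add_sq_pos (Real.sin u)).ne'
      unfold decayRoot invRoot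
      field_simp
      nlinarith
    exact_mod_cast this
  rw [hsin]
  generalize (decayRoot u : ℂ) = r at *
  generalize (invRoot u : ℂ) = A at *
  generalize (Real.sin u : ℂ) = s at *
  generalize Complex.exp (I * v) = z at *
  generalize Complex.exp (-(I * v)) = w at *
  have hD : (1 - r * w) * (1 + r * z) = -2 * I * r * (I * s - (w - z) * I / 2) := by
    linear_combination (-r ^ 2) * hzw - hr2 + (2 * r * s + r * z - r * w) * I_sq
  have hD0 : I * s - (w - z) * I / 2 ≠ 0 := by
    intro h
    rw [h, mul_zero] at hD
    exact mul_ne_zero hP hQ hD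
  have hpq : (1 - r * w)⁻¹ + (1 + r * z)⁻¹ - 1 = (1 + r ^ 2) / ((1 - r * w) * (1 + r * z)) := by
    field_simp
    linear_combination r ^ 2 * hzw
  rw [hpq, hD]
  have hI := I_ne_zero
  generalize I * s - (w - z) * I / 2 = D at *
  field_simp
  linear_combination -hA

/-- The integral over a period in `v` of `2 / (i sin u - sin v)` against a character. -/
def fiberCoeff (u : ℝ) (y : ℤ) : ℂ :=
  ∫ v in (-Real.pi)..Real.pi, 2 / (I * Real.sin u - Real.sin v) * Complex.exp (I * (v * y))

lemma exists_fiberCoeff_eq (y : ℤ) : ∃ ε : ℂ, ‖ε‖ = 4 * Real.pi ∧ ∀ u : ℝ, 0 < Real.sin u →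
    fiberCoeff u y = ε * invRoot u * (decayRoot u : ℂ) ^ y.natAbs := by
  refine ⟨-2 * I * (2 * Real.pi * if 0 ≤ y then 1 else (-1) ^ y.natAbs), ?_, fun u hu => ?_⟩
  · split_ifs <;> simp [abs_of_pos Real.pi_pos] <;> ring
  have hr : |decayRoot u| < 1 := by rw [abs_of_pos (decayRoot_pos u)]; exact decayRoot_lt_one hu
  have hP (v : ℝ) : 1 - (decayRoot u : ℂ) * Complex.exp (-(I * v)) ≠ 0 := by
    simpa using one_sub_mul_exp_ne_zero hr (-v)
  have hQ (v : ℝ) : 1 + (decayRoot u : ℂ) * Complex.exp (I * v) ≠ 0 := by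
    simpa using one_sub_mul_exp_ne_zero (ρ := -decayRoot u) (by rwa [abs_neg]) v
  have hcP : Continuous fun v : ℝ => Complex.exp (I * (v * y)) *
      (1 - (decayRoot u : ℂ) * Complex.exp (-(I * v)))⁻¹ :=
    Continuous.mul (by fun_prop) (Continuous.inv₀ (by fun_prop) hP)
  have hcQ : Continuous fun v : ℝ => Complex.exp (I * (v * y)) *
      (1 + (decayRoot u : ℂ) * Complex.exp (I * v))⁻¹ :=
    Continuous.mul (by fun_prop) (Continuous.inv₀ (by fun_prop) hQ)
  have hcPQ : Continuous fun v : ℝ => Complex.exp (I * (v * y)) *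
      (1 - (decayRoot u : ℂ) * Complex.exp (-(I * v)))⁻¹ + Complex.exp (I * (v * y)) *
      (1 + (decayRoot u : ℂ) * Complex.exp (I * v))⁻¹ := hcP.add hcQ
  have hsplit : (fun v : ℝ => 2 / (I * Real.sin u - Real.sin v) * Complex.exp (I * (v * y))) =
      fun v : ℝ => -2 * I * invRoot u * (Complex.exp (I * (v * y)) *
        (1 - (decayRoot u : ℂ) * Complex.exp (-(I * v)))⁻¹ + Complex.exp (I * (v * y)) *
        (1 + (decayRoot u : ℂ) * Complex.exp (I * v))⁻¹ - Complex.exp (I * (v * y))) := by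
    funext v
    rw [two_div_eq_partial_fractions hu]
    ring
  rw [fiberCoeff, hsplit, intervalIntegral.integral_const_mul,
    intervalIntegral.integral_sub (hcPQ.intervalIntegrable _ _)
      (Continuous.intervalIntegrable (by fun_prop) _ _),
    intervalIntegral.integral_add (hcP.intervalIntegrable _ _) (hcQ.intervalIntegrable _ _),
    integral_exp_mul_inv_one_sub hr, integral_exp_mul_inv_one_add hr, integral_exp_I_mul_int]
  rcases lt_trichotomy y 0 with h | rfl | h
  · rw [if_neg h.not_ge, if_pos h.le, if_neg h.ne, if_neg h.not_ge, neg_pow]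
    ring
  · simp
    ring
  · rw [if_pos h.le, if_neg h.not_ge, if_neg h.ne', if_pos h.le]
    ring

lemma fiberCoeff_neg (u : ℝ) (y : ℤ) : fiberCoeff (-u) y = -fiberCoeff u (-y) := by
  have h := intervalIntegral.integral_comp_neg (a := -Real.pi) (b := Real.pi)
    (fun v : ℝ => 2 / (I * Real.sin (-u) - Real.sin v) * Complex.exp (I * (v * y)))
  rw [neg_neg] at h
  rw [fiberCoeff, ← h, fiberCoeff, ← intervalIntegral.integral_neg]
  congr 1
  funext v
  have h1 : I * (Real.sin (-u) : ℂ) - Real.sin (-v) = -(I * Real.sin u - Real.sin v) := by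
    rw [Real.sin_neg, Real.sin_neg]
    push_cast
    ring
  rw [h1, div_neg, neg_mul]
  push_cast
  ring_nf

lemma norm_integral_sin_sq_mul_fiberCoeff (x y : ℤ) :
    ‖∫ u in (0 : ℝ)..Real.pi, (Real.sin u : ℂ) ^ 2 * Complex.exp (I * (u * x)) * fiberCoeff u y‖ =
      4 * Real.pi * ‖profileCoeff y.natAbs x‖ := by
  obtain ⟨ε, hε, h⟩ := exists_fiberCoeff_eq y
  rw [← hε, ← norm_mul, profileCoeff, ← intervalIntegral.integral_const_mul]
  congr 1
  refine intervalIntegral.integral_congr fun u hu => ?_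
  rw [uIcc_of_le Real.pi_pos.le] at hu
  simp only [profile]
  rcases (Real.sin_nonneg_of_mem_Icc hu).eq_or_lt with h0 | h0
  · simp [← h0]
  · rw [h u h0]
    push_cast
    ring

/-- The square `[-π, π]²`. -/
def periodBox : Set (ℝ × ℝ) :=
  Set.Icc (-Real.pi) Real.pi ×ˢ Set.Icc (-Real.pi) Real.pi

/-- The character of the torus with frequency `p`. -/
def latticeChar (p : ℤ × ℤ) (w : ℝ × ℝ) : ℂ := Complex.exp (I * (w.1 * p.1 + w.2 * p.2))

/-- The function on `ℤ²` with symbol `φ`. -/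
def boxCoeff (φ : ℝ × ℝ → ℂ) (p : ℤ × ℤ) : ℂ :=
  (1 / (4 * Real.pi ^ 2)) • ∫ w in periodBox, φ w * latticeChar p w

lemma continuous_latticeChar (p : ℤ × ℤ) : Continuous (latticeChar p) := by
  unfold latticeChar
  fun_prop

lemma norm_latticeChar (p : ℤ × ℤ) (w : ℝ × ℝ) : ‖latticeChar p w‖ = 1 := by
  have h : I * ((w.1 : ℂ) * p.1 + w.2 * p.2) = I * ((w.1 * p.1 + w.2 * p.2 : ℝ) : ℂ) := by
    push_cast; ring
  rw [latticeChar, h, Complex.norm_exp_I_mul_ofReal]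

lemma latticeChar_add (p q : ℤ × ℤ) (w : ℝ × ℝ) :
    latticeChar (p + q) w = latticeChar p w * latticeChar q w := by
  simp only [latticeChar, ← Complex.exp_add, Prod.fst_add, Prod.snd_add]
  push_cast
  ring_nf

lemma integrableOn_mul_latticeChar {φ : ℝ × ℝ → ℂ} (hφ : IntegrableOn φ periodBox)
    (p : ℤ × ℤ) : IntegrableOn (fun w => φ w * latticeChar p w) periodBox :=
  Integrable.mul_bdd (c := 1) hφ (continuous_latticeChar p).aestronglyMeasurable
    (.of_forall fun w => (norm_latticeChar p w).le)

lemma integrableOn_I_mul_sin_fst {φ : ℝ × ℝ → ℂ} (hφ : IntegrableOn φ periodBox) :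
    IntegrableOn (fun w => I * Real.sin w.1 * φ w) periodBox :=
  Integrable.bdd_mul (c := 1) hφ (Continuous.aestronglyMeasurable (by fun_prop))
    (.of_forall fun w => by
      rw [norm_mul, norm_I, one_mul, Complex.norm_real]; exact Real.abs_sin_le_one _)

lemma D1_boxCoeff {φ : ℝ × ℝ → ℂ} (hφ : IntegrableOn φ periodBox) :
    D1 (boxCoeff φ) = boxCoeff fun w => I * Real.sin w.1 * φ w := by
  funext p
  have h1 : latticeChar (p.1 + 1, p.2) = fun w => latticeChar p w * Complex.exp (I * w.1) := by
    funext w; rw [latticeChar, latticeChar, ← Complex.exp_add]; push_cast; ring_nf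
  have h2 : latticeChar (p.1 - 1, p.2) = fun w => latticeChar p w * Complex.exp (-(I * w.1)) := by
    funext w; rw [latticeChar, latticeChar, ← Complex.exp_add]; push_cast; ring_nf
  rw [D1, boxCoeff, boxCoeff, boxCoeff, ← smul_sub, ← integral_sub
    (integrableOn_mul_latticeChar hφ _) (integrableOn_mul_latticeChar hφ _), smul_div_assoc,
    ← integral_div]
  congr 2
  funext w
  rw [h1, h2, Complex.ofReal_sin, Complex.sin, neg_mul, mul_comm (w.1 : ℂ) I]
  linear_combination (-(φ w * latticeChar p w *
    (Complex.exp (-(I * w.1)) - Complex.exp (I * w.1))) / 2) * I_sq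

lemma D2_boxCoeff {φ : ℝ × ℝ → ℂ} (hφ : IntegrableOn φ periodBox) :
    D2 (boxCoeff φ) = boxCoeff fun w => I * Real.sin w.2 * φ w := by
  funext p
  have h1 : latticeChar (p.1, p.2 + 1) = fun w => latticeChar p w * Complex.exp (I * w.2) := by
    funext w; rw [latticeChar, latticeChar, ← Complex.exp_add]; push_cast; ring_nf
  have h2 : latticeChar (p.1, p.2 - 1) = fun w => latticeChar p w * Complex.exp (-(I * w.2)) := by
    funext w; rw [latticeChar, latticeChar, ← Complex.exp_add]; push_cast; ring_nf
  rw [D2, boxCoeff, boxCoeff, boxCoeff, ← smul_sub, ← integral_sub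
    (integrableOn_mul_latticeChar hφ _) (integrableOn_mul_latticeChar hφ _), smul_div_assoc,
    ← integral_div]
  congr 2
  funext w
  rw [h1, h2, Complex.ofReal_sin, Complex.sin, neg_mul, mul_comm (w.2 : ℂ) I]
  linear_combination (-(φ w * latticeChar p w *
    (Complex.exp (-(I * w.2)) - Complex.exp (I * w.2))) / 2) * I_sq

lemma setIntegral_Icc_neg_pi_pi (f : ℝ → ℂ) :
    ∫ v in Icc (-Real.pi) Real.pi, f v = ∫ v in (-Real.pi)..Real.pi, f v := by
  rw [integral_Icc_eq_integral_Ioc,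
    ← intervalIntegral.integral_of_le (by linarith [Real.pi_pos])]

lemma boxCoeff_one_eq_zero {p : ℤ × ℤ} (hp : p ≠ 0) : boxCoeff (fun _ => 1) p = 0 := by
  have h : (fun w : ℝ × ℝ => 1 * latticeChar p w) =
      fun w => Complex.exp (I * (w.1 * p.1)) * Complex.exp (I * (w.2 * p.2)) := by
    funext w
    rw [one_mul, latticeChar, ← Complex.exp_add, mul_add]
  rw [boxCoeff, h, periodBox, Measure.volume_eq_prod,
    setIntegral_prod_mul (fun u : ℝ => Complex.exp (I * (u * p.1)))
      (fun v : ℝ => Complex.exp (I * (v * p.2))),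
    setIntegral_Icc_neg_pi_pi, setIntegral_Icc_neg_pi_pi, integral_exp_I_mul_int,
    integral_exp_I_mul_int]
  have : p.1 ≠ 0 ∨ p.2 ≠ 0 := by
    by_contra! hc
    exact hp (Prod.ext hc.1 hc.2)
  rcases this with h | h <;> simp [h]

lemma summable_norm_boxCoeff_one : Summable fun p => ‖boxCoeff (fun _ => 1) p‖ :=
  summable_of_ne_finset_zero (s := {0}) fun p hp => by
    rw [boxCoeff_one_eq_zero (by simpa using hp), norm_zero]

lemma ae_sin_fst_ne_zero : ∀ᵐ w : ℝ × ℝ, Real.sin w.1 ≠ 0 := by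
  have hc : {u : ℝ | Real.sin u = 0}.Countable := by
    refine (countable_range fun n : ℤ => (n : ℝ) * Real.pi).mono fun u hu => ?_
    obtain ⟨n, hn⟩ := Real.sin_eq_zero_iff.1 hu
    exact ⟨n, hn⟩
  have h : ∀ᵐ u : ℝ, Real.sin u ≠ 0 := by
    simpa using hc.ae_notMem volume
  exact Measure.quasiMeasurePreserving_fst.ae h

/-- The symbol `2 / (i sin u - sin v)` of `Efun`. -/
def fundamentalSymbol (w : ℝ × ℝ) : ℂ := 2 / (I * Real.sin w.1 - Real.sin w.2)

lemma Efun_eq_boxCoeff : Efun = boxCoeff fundamentalSymbol := rfl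

lemma dbarZ_Efun (hE : IntegrableOn fundamentalSymbol periodBox) :
    dbarZ Efun = boxCoeff fun _ => 1 := by
  have hI2 : IntegrableOn (fun w => I * Real.sin w.2 * fundamentalSymbol w) periodBox :=
    Integrable.bdd_mul (c := 1) hE (Continuous.aestronglyMeasurable (by fun_prop))
      (.of_forall fun w => by
        rw [norm_mul, norm_I, one_mul, Complex.norm_real]; exact Real.abs_sin_le_one _)
  funext p
  rw [dbarZ, Efun_eq_boxCoeff, D1_boxCoeff hE, D2_boxCoeff hE, boxCoeff, boxCoeff, boxCoeff,
    mul_smul_comm, ← smul_add, mul_smul_comm, ← integral_const_mul,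
    ← integral_add (integrableOn_mul_latticeChar (integrableOn_I_mul_sin_fst hE) p)
      ((integrableOn_mul_latticeChar hI2 p).const_mul I), ← integral_const_mul]
  congr 1
  refine integral_congr_ae (ae_restrict_of_ae ?_)
  filter_upwards [ae_sin_fst_ne_zero] with w hw
  have hD : I * (Real.sin w.1 : ℂ) - Real.sin w.2 ≠ 0 := by
    intro h
    have := congrArg Complex.im h
    simp only [sub_im, mul_im, I_re, I_im, ofReal_im, ofReal_re, zero_im] at this
    exact hw (by linarith)
  simp only [fundamentalSymbol]
  field_simp
  linear_combination (latticeChar p w * Real.sin w.2) * I_sq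

lemma summable_norm_D1 {f : ℤ × ℤ → ℂ} (hf : Summable fun p => ‖f p‖) :
    Summable fun p => ‖D1 f p‖ := by
  have h1 := hf.comp_injective (i := fun p : ℤ × ℤ => (p.1 + 1, p.2)) fun p q h => by
    simpa [Prod.ext_iff] using h
  have h2 := hf.comp_injective (i := fun p : ℤ × ℤ => (p.1 - 1, p.2)) fun p q h => by
    simpa [Prod.ext_iff] using h
  exact ((h1.of_norm.sub h2.of_norm).div_const 2).norm

lemma summable_norm_D2 {f : ℤ × ℤ → ℂ} (hf : Summable fun p => ‖f p‖) :
    Summable fun p => ‖D2 f p‖ := by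
  have h1 := hf.comp_injective (i := fun p : ℤ × ℤ => (p.1, p.2 + 1)) fun p q h => by
    simpa [Prod.ext_iff] using h
  have h2 := hf.comp_injective (i := fun p : ℤ × ℤ => (p.1, p.2 - 1)) fun p q h => by
    simpa [Prod.ext_iff] using h
  exact ((h1.of_norm.sub h2.of_norm).div_const 2).norm

lemma summable_norm_dbarZ {f : ℤ × ℤ → ℂ} (hf : Summable fun p => ‖f p‖) :
    Summable fun p => ‖dbarZ f p‖ :=
  (((summable_norm_D1 hf).of_norm.add ((summable_norm_D2 hf).of_norm.mul_left I)).mul_left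
    (1 / 2)).norm

lemma dzZ_dzZ_eq (f : ℤ × ℤ → ℂ) (p : ℤ × ℤ) :
    dzZ (dzZ f) p = D1 (D1 f) p - 2 * D1 (dbarZ f) p + dbarZ (dbarZ f) p := by
  simp only [dzZ, dbarZ, D1, D2]
  ring_nf

lemma norm_D1_D1_Efun_le (hE : IntegrableOn fundamentalSymbol periodBox) (p : ℤ × ℤ) :
    ‖D1 (D1 Efun) p‖ ≤ 1 / Real.pi *
      (‖profileCoeff p.2.natAbs p.1‖ + ‖profileCoeff (-p).2.natAbs (-p).1‖) := by
  have hint := integrableOn_mul_latticeChar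
    (integrableOn_I_mul_sin_fst (integrableOn_I_mul_sin_fst hE)) p
  set Φ : ℝ → ℂ := fun u => (Real.sin u : ℂ) ^ 2 * Complex.exp (I * (u * p.1)) * fiberCoeff u p.2
    with hΦ
  have hfib (u : ℝ) : ∫ v in Icc (-Real.pi) Real.pi, I * Real.sin u * (I * Real.sin u *
      fundamentalSymbol (u, v)) * latticeChar p (u, v) = -Φ u := by
    rw [setIntegral_Icc_neg_pi_pi, hΦ]
    simp only [fiberCoeff]
    rw [← intervalIntegral.integral_const_mul, ← intervalIntegral.integral_neg]
    congr 1
    funext v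
    rw [latticeChar, mul_add, Complex.exp_add, fundamentalSymbol]
    linear_combination ((Real.sin u : ℂ) ^ 2 * (2 / (I * Real.sin u - Real.sin v)) *
      Complex.exp (I * (u * p.1)) * Complex.exp (I * (v * p.2))) * I_sq
  have hΦint : IntegrableOn Φ (Icc (-Real.pi) Real.pi) := by
    rw [periodBox, IntegrableOn, Measure.volume_eq_prod, ← Measure.prod_restrict] at hint
    have := hint.integral_prod_left
    simp only [hfib] at this
    simpa [IntegrableOn] using this.neg
  have hsub (a b : ℝ) (ha : a ∈ Icc (-Real.pi) Real.pi) (hb : b ∈ Icc (-Real.pi) Real.pi) :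
      IntervalIntegrable Φ volume a b :=
    (hΦint.mono_set (uIcc_subset_Icc ha hb)).intervalIntegrable
  have hp := Real.pi_pos
  have hneg : ∫ u in (-Real.pi)..0, Φ u = -∫ u in (0 : ℝ)..Real.pi,
      (Real.sin u : ℂ) ^ 2 * Complex.exp (I * (u * (-p).1)) * fiberCoeff u (-p).2 := by
    have h := intervalIntegral.integral_comp_neg (a := 0) (b := Real.pi) Φ
    rw [neg_zero] at h
    rw [← h, ← intervalIntegral.integral_neg]
    congr 1
    funext u
    simp only [hΦ, fiberCoeff_neg, Real.sin_neg, Prod.fst_neg, Prod.snd_neg]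
    push_cast
    ring_nf
  have hI : IntegrableOn (fun w => I * Real.sin w.1 * (I * Real.sin w.1 * fundamentalSymbol w) *
      latticeChar p w) (Icc (-Real.pi) Real.pi ×ˢ Icc (-Real.pi) Real.pi)
      ((volume : Measure ℝ).prod volume) := hint
  rw [Efun_eq_boxCoeff, D1_boxCoeff hE, D1_boxCoeff (integrableOn_I_mul_sin_fst hE), boxCoeff,
    periodBox, Measure.volume_eq_prod, setIntegral_prod _ hI]
  simp only [hfib]
  rw [integral_neg, setIntegral_Icc_neg_pi_pi, ← intervalIntegral.integral_add_adjacent_intervals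
    (hsub _ 0 ⟨le_rfl, by linarith⟩ ⟨by linarith, hp.le⟩)
    (hsub 0 _ ⟨by linarith, hp.le⟩ ⟨by linarith, le_rfl⟩), hneg, norm_smul, norm_neg]
  calc _ ≤ ‖1 / (4 * Real.pi ^ 2)‖ * (4 * Real.pi * ‖profileCoeff (-p).2.natAbs (-p).1‖ +
          4 * Real.pi * ‖profileCoeff p.2.natAbs p.1‖) := by
        refine mul_le_mul_of_nonneg_left ((norm_add_le _ _).trans_eq ?_) (norm_nonneg _)
        rw [norm_neg, norm_integral_sin_sq_mul_fiberCoeff, hΦ,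
          norm_integral_sin_sq_mul_fiberCoeff]
    _ = _ := by
        rw [Real.norm_of_nonneg (by positivity)]
        field_simp
        ring

lemma summable_norm_D1_D1_Efun (hE : IntegrableOn fundamentalSymbol periodBox) :
    Summable fun p => ‖D1 (D1 Efun) p‖ := by
  have h := summable_norm_profileCoeff
  have h2 := h.comp_injective (neg_injective (G := ℤ × ℤ))
  exact ((h.add h2).mul_left (1 / Real.pi)).of_nonneg_of_le (fun _ => norm_nonneg _)
    (norm_D1_D1_Efun_le hE)

lemma Efun_eq_zero_of_not_integrableOn (hE : ¬ IntegrableOn fundamentalSymbol periodBox) :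
    Efun = 0 := by
  funext p
  have h : ¬ IntegrableOn (fun w => fundamentalSymbol w * latticeChar p w) periodBox := by
    intro hp
    refine hE (Integrable.congr (integrableOn_mul_latticeChar hp (-p)) (.of_forall fun w => ?_))
    simp only [mul_assoc, ← latticeChar_add, add_neg_cancel]
    simp [latticeChar]
  rw [Efun_eq_boxCoeff, boxCoeff, integral_undef h, smul_zero, Pi.zero_apply]

/-- the second symmetric discrete derivative `(∂_z^1)² E` belongs to `ℓ¹(ℤ²)`. -/
theorem stmt10 : Memℓp (dzZ (dzZ Efun)) (1 : ℝ≥0∞) := by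
  refine memℓp_gen ?_
  simp only [ENNReal.toReal_one, Real.rpow_one]
  by_cases hE : IntegrableOn fundamentalSymbol periodBox
  · have hone := summable_norm_boxCoeff_one
    simp only [dzZ_dzZ_eq, dbarZ_Efun hE]
    exact (((summable_norm_D1_D1_Efun hE).of_norm.sub
      ((summable_norm_D1 hone).of_norm.mul_left 2)).add (summable_norm_dbarZ hone).of_norm).norm
  · rw [Efun_eq_zero_of_not_integrableOn hE]
    simp [dzZ, D1, D2, summable_zero]

end
end

section
/- (Discrete Cauchy integral formula) If B is a bounded subset of Z_h^2 and f: closure(B) → C is discrete holomorphic on B (i.e., ∂_z̄^h f = 0 on B), then for every ζ ∈ Z_h^2, χ_B(ζ) f(ζ) = ∫_{∂B} K^h(z,ζ) f(z) dS(z). In particular the boundary integral reproduces f(ζ) for ζ ∈ ∂B ∩ B and equals 0 for ζ ∈ ∂B \ B. -/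
noncomputable section
open Complex MeasureTheory Set
open scoped ENNReal

lemma integrableOn_abs_sin_rpow :
    IntegrableOn (fun x : ℝ => |Real.sin x| ^ (-(1 / 2) : ℝ)) (Icc (-Real.pi) Real.pi) := by
  have hpi := Real.pi_pos
  have h1 : IntervalIntegrable (fun x : ℝ => |Real.sin x| ^ (-(1 / 2) : ℝ)) volume 0
      (Real.pi / 2) := by
    have hx : IntervalIntegrable (fun x : ℝ => (2 / Real.pi) ^ (-(1 / 2) : ℝ) * x ^ (-(1 / 2) : ℝ))
        volume 0 (Real.pi / 2) :=
      (intervalIntegral.intervalIntegrable_rpow' (by norm_num)).const_mul _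
    refine hx.mono_fun' (Measurable.aestronglyMeasurable (by fun_prop)) ?_
    refine (ae_restrict_iff' measurableSet_uIoc).2 (Filter.Eventually.of_forall fun x hx => ?_)
    rw [uIoc_of_le (by positivity)] at hx
    beta_reduce
    have h2 := Real.mul_le_sin hx.1.le hx.2
    have h3 : 0 < 2 / Real.pi * x := by have := hx.1; positivity
    rw [← Real.mul_rpow (by positivity) hx.1.le, Real.norm_of_nonneg (by positivity)]
    exact Real.rpow_le_rpow_of_nonpos h3 (h2.trans (le_abs_self _)) (by norm_num)
  have h2 : IntervalIntegrable (fun x : ℝ => |Real.sin x| ^ (-(1 / 2) : ℝ)) volume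
      (Real.pi / 2) Real.pi := by
    have := h1.comp_sub_left Real.pi
    simp only [Real.sin_pi_sub, sub_zero, sub_half] at this
    exact this.symm
  have h3 := h1.trans h2
  have h4 : IntervalIntegrable (fun x : ℝ => |Real.sin x| ^ (-(1 / 2) : ℝ)) volume
      (-Real.pi) 0 := by
    have := (IntervalIntegrable.iff_comp_neg (by finiteness)).1 h3
    simp only [Real.sin_neg, abs_neg, neg_zero] at this
    exact this.symm
  exact (intervalIntegrable_iff_integrableOn_Icc_of_le (by linarith)).1 (h4.trans h3)

lemma ae_sin_ne_zero : ∀ᵐ x : ℝ, Real.sin x ≠ 0 := by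
  have : {x : ℝ | Real.sin x = 0} = range fun n : ℤ => (n : ℝ) * Real.pi := by
    ext x; simp [Real.sin_eq_zero_iff]
  have hc : {x : ℝ | Real.sin x = 0}.Countable := this ▸ countable_range _
  exact hc.ae_notMem volume

lemma ae_sin_fst_snd_ne_zero :
    ∀ᵐ w : ℝ × ℝ ∂volume.restrict (Icc (-Real.pi) Real.pi ×ˢ Icc (-Real.pi) Real.pi),
      Real.sin w.1 ≠ 0 ∧ Real.sin w.2 ≠ 0 := by
  refine ae_restrict_of_ae ?_
  exact (MeasureTheory.Measure.quasiMeasurePreserving_fst.ae ae_sin_ne_zero).and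
    (MeasureTheory.Measure.quasiMeasurePreserving_snd.ae ae_sin_ne_zero)

lemma norm_two_div_le {a b : ℝ} (ha : a ≠ 0) (hb : b ≠ 0) :
    ‖(2 : ℂ) / (I * a - b)‖ ≤ 2 * (|a| ^ (-(1 / 2) : ℝ) * |b| ^ (-(1 / 2) : ℝ)) := by
  have ha' : 0 < |a| := abs_pos.2 ha
  have hb' : 0 < |b| := abs_pos.2 hb
  have hz : |a| * |b| ≤ ‖I * (a : ℂ) - b‖ ^ 2 := by
    rw [Complex.sq_norm, Complex.normSq_apply]
    simp only [sub_re, mul_re, I_re, ofReal_re, I_im, ofReal_im, sub_im, mul_im]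
    nlinarith [sq_nonneg (|a| - |b|), sq_abs a, sq_abs b]
  have h1 : (|a| * |b|) ^ (1 / 2 : ℝ) ≤ ‖I * (a : ℂ) - b‖ := by
    rw [← Real.sqrt_eq_rpow]
    exact Real.sqrt_le_iff.2 ⟨norm_nonneg _, hz⟩
  have h0 : 0 < (|a| * |b|) ^ (1 / 2 : ℝ) := by positivity
  rw [← Real.mul_rpow ha'.le hb'.le, Real.rpow_neg (by positivity), norm_div, ← div_eq_mul_inv]
  simp only [Complex.norm_ofNat]
  gcongr

lemma integrable_Efun_integrand (p : ℤ × ℤ) :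
    Integrable (fun w : ℝ × ℝ => (2 / (Complex.I * Real.sin w.1 - Real.sin w.2)) *
        Complex.exp (Complex.I * (w.1 * p.1 + w.2 * p.2)))
      (volume.restrict (Icc (-Real.pi) Real.pi ×ˢ Icc (-Real.pi) Real.pi)) := by
  refine Integrable.mul_bdd (c := 1) ?_ (by fun_prop) (Filter.Eventually.of_forall fun w => ?_)
  · have h := (integrableOn_abs_sin_rpow.integrable.mul_prod
      integrableOn_abs_sin_rpow.integrable).const_mul 2
    rw [Measure.prod_restrict, ← Measure.volume_eq_prod] at h
    refine h.mono' (Measurable.aestronglyMeasurable (by fun_prop)) ?_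
    filter_upwards [ae_sin_fst_snd_ne_zero] with w hw
    exact norm_two_div_le hw.1 hw.2
  · have : I * ((w.1 : ℂ) * p.1 + w.2 * p.2) = ((w.1 * p.1 + w.2 * p.2 : ℝ) : ℂ) * I := by
      push_cast; ring
    rw [this, Complex.norm_exp_ofReal_mul_I]

lemma integral_exp_int (n : ℤ) :
    ∫ x in Icc (-Real.pi) Real.pi, Complex.exp (I * (x * n)) =
      (if n = 0 then 2 * Real.pi else 0 : ℝ) := by
  rw [integral_Icc_eq_integral_Ioc, ← intervalIntegral.integral_of_le (by linarith [Real.pi_pos])]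
  split_ifs with hn
  · subst hn; simp; ring
  · have hc : I * (n : ℂ) ≠ 0 := mul_ne_zero I_ne_zero (by exact_mod_cast hn)
    have h1 : ∀ x : ℝ, I * (x * (n : ℂ)) = I * n * x := fun x => by ring
    simp only [h1]
    rw [integral_exp_mul_complex hc]
    have h2 : Complex.exp (I * n * (Real.pi : ℝ)) = Complex.exp (I * n * ((-Real.pi : ℝ) : ℂ)) := by
      rw [Complex.exp_eq_exp_iff_exists_int]
      exact ⟨n, by push_cast; ring⟩
    rw [h2, sub_self, zero_div, ofReal_zero]

lemma Efun_integrand_difference {a b : ℝ} (ha : Real.sin a ≠ 0) (m n : ℂ) :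
    (2 / (I * Real.sin a - Real.sin b)) * Complex.exp (I * (a * (m + 1) + b * n)) -
      (2 / (I * Real.sin a - Real.sin b)) * Complex.exp (I * (a * (m - 1) + b * n)) +
      I * ((2 / (I * Real.sin a - Real.sin b)) * Complex.exp (I * (a * m + b * (n + 1))) -
      (2 / (I * Real.sin a - Real.sin b)) * Complex.exp (I * (a * m + b * (n - 1)))) =
    4 * (Complex.exp (I * (a * m)) * Complex.exp (I * (b * n))) := by
  have hne : I * (Real.sin a : ℂ) - Real.sin b ≠ 0 := fun h => ha (by
    simpa [-ofReal_sin] using congrArg Complex.im h)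
  have e1 : Complex.exp (I * (a * (m + 1) + b * n)) =
      Complex.exp (I * (a * m)) * Complex.exp (I * (b * n)) * Complex.exp (a * I) := by
    rw [← Complex.exp_add, ← Complex.exp_add]; ring_nf
  have e2 : Complex.exp (I * (a * (m - 1) + b * n)) =
      Complex.exp (I * (a * m)) * Complex.exp (I * (b * n)) * Complex.exp (-a * I) := by
    rw [← Complex.exp_add, ← Complex.exp_add]; ring_nf
  have e3 : Complex.exp (I * (a * m + b * (n + 1))) =
      Complex.exp (I * (a * m)) * Complex.exp (I * (b * n)) * Complex.exp (b * I) := by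
    rw [← Complex.exp_add, ← Complex.exp_add]; ring_nf
  have e4 : Complex.exp (I * (a * m + b * (n - 1))) =
      Complex.exp (I * (a * m)) * Complex.exp (I * (b * n)) * Complex.exp (-b * I) := by
    rw [← Complex.exp_add, ← Complex.exp_add]; ring_nf
  rw [e1, e2, e3, e4]
  simp only [Complex.exp_mul_I, Complex.cos_neg, Complex.sin_neg]
  push_cast at hne ⊢
  field_simp
  linear_combination (4 * Complex.sin b) * I_sq

/-- `Efun` is a fundamental solution of the symmetric discrete `∂̄`-operator on `ℤ²`. -/
lemma Efun_difference (m n : ℤ) :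
    Efun (m + 1, n) - Efun (m - 1, n) + I * (Efun (m, n + 1) - Efun (m, n - 1)) =
      if m = 0 ∧ n = 0 then 4 else 0 := by
  have hpi : (Real.pi : ℂ) ≠ 0 := by exact_mod_cast Real.pi_ne_zero
  set μ : Measure (ℝ × ℝ) :=
    volume.restrict (Icc (-Real.pi) Real.pi ×ˢ Icc (-Real.pi) Real.pi) with hμ
  let G : ℤ × ℤ → ℝ × ℝ → ℂ := fun p w => (2 / (I * Real.sin w.1 - Real.sin w.2)) *
    Complex.exp (I * (w.1 * p.1 + w.2 * p.2))
  have hG : ∀ p, Integrable (G p) μ := integrable_Efun_integrand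
  have hE : ∀ p, Efun p = (1 / (4 * Real.pi ^ 2)) • ∫ w, G p w ∂μ := fun p => rfl
  have key : ∀ p q r s : ℤ × ℤ, Efun p - Efun q + I * (Efun r - Efun s) =
      (1 / (4 * Real.pi ^ 2)) • ∫ w, (G p w - G q w + I * (G r w - G s w)) ∂μ := by
    intro p q r s
    rw [integral_add (f := fun w => G p w - G q w) (g := fun w => I * (G r w - G s w))
      ((hG p).sub (hG q)) (((hG r).sub (hG s)).const_mul I),
      integral_sub (hG p) (hG q), integral_const_mul, integral_sub (hG r) (hG s)]
    simp only [hE, smul_add, smul_sub, mul_sub, mul_smul_comm]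
  have hI : (∫ w, 4 * (Complex.exp (I * (w.1 * m)) * Complex.exp (I * (w.2 * n))) ∂μ) =
      4 * ((if m = 0 then 2 * Real.pi else 0 : ℝ) * (if n = 0 then 2 * Real.pi else 0 : ℝ)) := by
    rw [hμ, integral_const_mul, Measure.volume_eq_prod,
      setIntegral_prod_mul (fun x : ℝ => Complex.exp (I * (x * m)))
        (fun x : ℝ => Complex.exp (I * (x * n))), integral_exp_int, integral_exp_int]
  rw [key, integral_congr_ae (g := fun w : ℝ × ℝ =>
    4 * (Complex.exp (I * (w.1 * m)) * Complex.exp (I * (w.2 * n)))), hI]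
  · by_cases hm : m = 0 <;> by_cases hn : n = 0 <;> simp [hm, hn]
    field_simp
    norm_num
  · filter_upwards [ae_sin_fst_snd_ne_zero] with w hw
    rw [← Efun_integrand_difference hw.1]
    simp only [G]
    push_cast
    rfl

lemma Eh_lattice {h : ℝ} (hh : 0 < h) {z : ℂ} (m n : ℤ) (hz : z = h * (m + n * I)) :
    Eh h z = 1 / h * Efun (m, n) := by
  have h1 : z.re / h = m := by rw [hz]; simp; field_simp
  have h2 : z.im / h = n := by rw [hz]; simp; field_simp
  rw [Eh, h1, h2, round_intCast, round_intCast]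

/-- The rescaled fundamental solution inverts the symmetric discrete `∂̄`-operator. -/
lemma Eh_difference {h : ℝ} (hh : 0 < h) {z ζ : ℂ} (hz : z ∈ latt h) (hζ : ζ ∈ latt h) :
    Eh h (h - (z - ζ)) - Eh h (-h - (z - ζ)) +
      I * (Eh h (h * I - (z - ζ)) - Eh h (-(h * I) - (z - ζ))) =
      if z = ζ then 4 / (h : ℂ) else 0 := by
  obtain ⟨a, b, rfl⟩ := hz
  obtain ⟨m, n, rfl⟩ := hζ
  have h0 : (h : ℂ) ≠ 0 := by exact_mod_cast hh.ne'
  rw [Eh_lattice hh (m - a + 1) (n - b) (by push_cast; ring),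
    Eh_lattice hh (m - a - 1) (n - b) (by push_cast; ring),
    Eh_lattice hh (m - a) (n - b + 1) (by push_cast; ring),
    Eh_lattice hh (m - a) (n - b - 1) (by push_cast; ring)]
  have hE := Efun_difference (m - a) (n - b)
  have hiff : (h * ((a : ℂ) + b * I) = h * (m + n * I)) ↔ (m - a = 0 ∧ n - b = 0) := by
    rw [mul_right_inj' h0, Complex.ext_iff]
    simp only [add_re, intCast_re, mul_re, I_re, mul_zero, intCast_im, I_im, mul_one, sub_self,
      add_zero, add_im, mul_im, zero_add, Int.cast_inj]
    omega
  simp only [hiff]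
  calc _ = 1 / (h : ℂ) * (Efun (m - a + 1, n - b) - Efun (m - a - 1, n - b) +
        I * (Efun (m - a, n - b + 1) - Efun (m - a, n - b - 1))) := by ring
    _ = _ := by
      rw [hE]
      split_ifs <;> ring

lemma finite_of_isBounded_subset_latt {h : ℝ} (hh : 0 < h) {B : Set ℂ} (hB : B ⊆ latt h)
    (hbd : Bornology.IsBounded B) : B.Finite := by
  obtain ⟨R, hR⟩ := hbd.exists_norm_le
  refine (((finite_Icc (-⌈R / h⌉) ⌈R / h⌉).prod (finite_Icc (-⌈R / h⌉) ⌈R / h⌉)).image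
    fun p : ℤ × ℤ => (h : ℂ) * (p.1 + p.2 * I)).subset fun z hz => ?_
  obtain ⟨m, n, hmn⟩ := hB hz
  have hle : ∀ k : ℤ, |h * k| ≤ R → k ∈ Icc (-⌈R / h⌉) ⌈R / h⌉ := fun k hk => by
    rw [abs_mul, abs_of_pos hh, mul_comm, ← le_div_iff₀ hh] at hk
    rw [mem_Icc, ← abs_le]
    exact_mod_cast hk.trans (Int.le_ceil _)
  refine ⟨(m, n), ⟨hle m ?_, hle n ?_⟩, hmn.symm⟩
  · simpa [hmn] using (Complex.abs_re_le_norm z).trans (hR z hz)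
  · simpa [hmn] using (Complex.abs_im_le_norm z).trans (hR z hz)

lemma hasSum_chi_add_mul {B : Set ℂ} (hfin : B.Finite) (c : ℂ) (g : ℂ → ℂ) :
    HasSum (fun z => (chi B (z + c) : ℂ) * g z) (∑ z ∈ hfin.toFinset, g (z - c)) := by
  have h1 : HasSum (fun w => (chi B w : ℂ) * g (w - c)) (∑ z ∈ hfin.toFinset, g (z - c)) := by
    have h2 : ∑ z ∈ hfin.toFinset, g (z - c) =
        ∑ z ∈ hfin.toFinset, (chi B z : ℂ) * g (z - c) :=
      Finset.sum_congr rfl fun z hz => by simp [chi, hfin.mem_toFinset.1 hz]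
    rw [h2]
    refine hasSum_sum_of_ne_finset_zero fun w hw => ?_
    simp [chi, mt hfin.mem_toFinset.2 hw]
  rw [← (Equiv.addRight c).hasSum_iff] at h1
  simpa [Function.comp_def] using h1

lemma normal_mul_density {Q d : ℝ} (h : ℝ) (hd : d ^ 2 ≤ Q) :
    -2 * d / √Q * (h ^ 2 / 2 * √Q) = -h ^ 2 * d := by
  rcases eq_or_ne (√Q) 0 with h0 | h0
  · have hQ : Q ≤ 0 := Real.sqrt_eq_zero'.1 h0
    have : d = 0 := pow_eq_zero_iff two_ne_zero |>.1 (le_antisymm (hd.trans hQ) (sq_nonneg d))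
    simp [this]
  · field_simp

/-- The Bochner-Martinelli kernel against the boundary measure, free of normalisation. -/
lemma Kker_mul_sden {h : ℝ} (hh : 0 < h) (B : Set ℂ) (z ζ : ℂ) :
    Kker h B z ζ * (sden h B z : ℂ) = h / 4 *
      (Eh h (h - (z - ζ)) * (chi B z - chi B (z - h)) +
        Eh h (-h - (z - ζ)) * (chi B (z + h) - chi B z) +
        I * Eh h (h * I - (z - ζ)) * (chi B z - chi B (z - h * I)) +
        I * Eh h (-(h * I) - (z - ζ)) * (chi B (z + h * I) - chi B z)) := by
  have h0 : (h : ℂ) ≠ 0 := by exact_mod_cast hh.ne'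
  have e1 : (n1m h B z : ℂ) * sden h B z = -h * (chi B z - chi B (z - h)) := by
    rw [← ofReal_mul, n1m, sden, normal_mul_density h (by rw [Qsum]; nlinarith), dm1]
    push_cast; field_simp
  have e2 : (n1p h B z : ℂ) * sden h B z = -h * (chi B (z + h) - chi B z) := by
    rw [← ofReal_mul, n1p, sden, normal_mul_density h (by rw [Qsum]; nlinarith), dp1]
    push_cast; field_simp
  have e3 : (n2m h B z : ℂ) * sden h B z = -h * (chi B z - chi B (z - h * I)) := by
    rw [← ofReal_mul, n2m, sden, normal_mul_density h (by rw [Qsum]; nlinarith), dm2]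
    push_cast; field_simp
  have e4 : (n2p h B z : ℂ) * sden h B z = -h * (chi B (z + h * I) - chi B z) := by
    rw [← ofReal_mul, n2p, sden, normal_mul_density h (by rw [Qsum]; nlinarith), dp2]
    push_cast; field_simp
  rw [Kker]
  linear_combination (-Eh h (h - (z - ζ)) / 4) * e1 + (-Eh h (-h - (z - ζ)) / 4) * e2 +
    I * (-Eh h (h * I - (z - ζ)) / 4) * e3 + I * (-Eh h (-(h * I) - (z - ζ)) / 4) * e4

lemma latt_add_mem_iff {h : ℝ} {z c : ℂ} (hc : c ∈ latt h) : z + c ∈ latt h ↔ z ∈ latt h := by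
  obtain ⟨a, b, rfl⟩ := hc
  constructor
  · rintro ⟨m, n, hmn⟩
    exact ⟨m - a, n - b, by push_cast; linear_combination hmn⟩
  · rintro ⟨m, n, rfl⟩
    exact ⟨m + a, n + b, by push_cast; ring⟩

lemma mem_latt_of_mem_nbhd {h : ℝ} {z w : ℂ} (hw : w ∈ nbhd h z) (hwl : w ∈ latt h) :
    z ∈ latt h := by
  simp only [nbhd, mem_insert_iff, mem_singleton_iff, sub_eq_add_neg] at hw
  rcases hw with rfl | rfl | rfl | rfl | rfl
  · exact hwl
  · exact (latt_add_mem_iff ⟨1, 0, by simp⟩).1 hwl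
  · exact (latt_add_mem_iff ⟨-1, 0, by simp⟩).1 hwl
  · exact (latt_add_mem_iff ⟨0, 1, by simp⟩).1 hwl
  · exact (latt_add_mem_iff ⟨0, -1, by simp⟩).1 hwl

/-- The characteristic function is constant on the neighbourhood of a non-boundary point. -/
lemma chi_eq_of_notMem_dBdry {h : ℝ} {B : Set ℂ} (hB : B ⊆ latt h) {z w : ℂ}
    (hz : z ∉ dBdry h B) (hw : w ∈ nbhd h z) : chi B w = chi B z := by
  have hzn : z ∈ nbhd h z := by simp [nbhd]
  by_cases h1 : w ∈ B <;> by_cases h2 : z ∈ B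
  · simp [chi, h1, h2]
  · exact absurd ⟨mem_latt_of_mem_nbhd hw (hB h1), ⟨w, hw, h1⟩, ⟨z, hzn, h2⟩⟩ hz
  · exact absurd ⟨hB h2, ⟨z, hzn, h2⟩, ⟨w, hw, h1⟩⟩ hz
  · simp [chi, h1, h2]

lemma hasSum_boundary {h : ℝ} (hh : 0 < h) {B : Set ℂ} (hB : B ⊆ latt h) (hfin : B.Finite)
    (f : ℂ → ℂ) (ζ : ℂ) :
    HasSum (fun z : dBdry h B => Kker h B z ζ * f z * (sden h B z : ℂ))
      (∑ z ∈ hfin.toFinset,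
        (h / 4 * (Eh h (h - (z - ζ)) - Eh h (-h - (z - ζ)) +
          I * (Eh h (h * I - (z - ζ)) - Eh h (-(h * I) - (z - ζ)))) * f z -
        h ^ 2 * Eh h (-(z - ζ)) * dbarC h f z)) := by
  have h0 : (h : ℂ) ≠ 0 := by exact_mod_cast hh.ne'
  have hT : ∀ z, Kker h B z ζ * f z * (sden h B z : ℂ) = h / 4 *
      (Eh h (h - (z - ζ)) * (chi B z - chi B (z - h)) +
        Eh h (-h - (z - ζ)) * (chi B (z + h) - chi B z) +
        I * Eh h (h * I - (z - ζ)) * (chi B z - chi B (z - h * I)) +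
        I * Eh h (-(h * I) - (z - ζ)) * (chi B (z + h * I) - chi B z)) * f z := fun z => by
    rw [← Kker_mul_sden hh]; ring
  refine (hasSum_subtype_iff_of_support_subset
    (f := fun z => Kker h B z ζ * f z * (sden h B z : ℂ)) fun z hz => ?_).2 ?_
  · by_contra hzb
    refine hz ?_
    have hc : ∀ w ∈ nbhd h z, chi B w = chi B z := fun w => chi_eq_of_notMem_dBdry hB hzb
    simp only [hT]
    rw [hc (z - h) (by simp [nbhd]), hc (z + h) (by simp [nbhd]),
      hc (z - h * I) (by simp [nbhd]), hc (z + h * I) (by simp [nbhd])]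
    ring
  · have s0 := hasSum_chi_add_mul hfin 0 fun z => h / 4 * (Eh h (h - (z - ζ)) -
      Eh h (-h - (z - ζ)) + I * (Eh h (h * I - (z - ζ)) - Eh h (-(h * I) - (z - ζ)))) * f z
    have s1 := hasSum_chi_add_mul hfin (-h) fun z => -(h / 4) * Eh h (h - (z - ζ)) * f z
    have s2 := hasSum_chi_add_mul hfin h fun z => h / 4 * Eh h (-h - (z - ζ)) * f z
    have s3 := hasSum_chi_add_mul hfin (-(h * I)) fun z =>
      -(h / 4) * (I * Eh h (h * I - (z - ζ))) * f z
    have s4 := hasSum_chi_add_mul hfin (h * I) fun z =>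
      h / 4 * (I * Eh h (-(h * I) - (z - ζ))) * f z
    convert (((s0.add s1).add s2).add s3).add s4 using 1
    · funext z
      rw [hT]
      simp only [add_zero, ← sub_eq_add_neg]
      ring
    · simp only [← Finset.sum_add_distrib]
      refine Finset.sum_congr rfl fun z _ => ?_
      have r1 : (h : ℂ) - (z + h - ζ) = -(z - ζ) := by ring
      have r2 : -(h : ℂ) - (z - h - ζ) = -(z - ζ) := by ring
      have r3 : (h : ℂ) * I - (z + h * I - ζ) = -(z - ζ) := by ring
      have r4 : -((h : ℂ) * I) - (z - h * I - ζ) = -(z - ζ) := by ring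
      simp only [sub_neg_eq_add, sub_zero, r1, r2, r3, r4, dbarC, cdp1, cdm1, cdp2, cdm2]
      field_simp
      ring

/-- Discrete Cauchy integral formula: if `f` is discrete holomorphic on `B`,
then `χ_B(ζ) f(ζ) = ∫_{∂B} K^h(z,ζ) f(z) dS(z)`; in particular the boundary integral
reproduces `f(ζ)` for `ζ ∈ ∂B ∩ B` and vanishes for `ζ ∈ ∂B \ B`. -/
theorem stmt12 (h : ℝ) (hh : 0 < h) (B : Set ℂ) (hB : B ⊆ latt h)
    (hbd : Bornology.IsBounded B) (f : ℂ → ℂ) (hf : ∀ z ∈ B, dbarC h f z = 0) :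
    (∀ ζ ∈ latt h,
      B.indicator f ζ = ∑' z : (dBdry h B), Kker h B z ζ * f z * (sden h B z : ℂ)) ∧
    (∀ ζ ∈ dBdry h B ∩ B,
      (∑' z : (dBdry h B), Kker h B z ζ * f z * (sden h B z : ℂ)) = f ζ) ∧
    (∀ ζ ∈ dBdry h B \ B,
      (∑' z : (dBdry h B), Kker h B z ζ * f z * (sden h B z : ℂ)) = 0) := by
  have hfin := finite_of_isBounded_subset_latt hh hB hbd
  have h0 : (h : ℂ) ≠ 0 := by exact_mod_cast hh.ne'
  have key : ∀ ζ ∈ latt h,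
      B.indicator f ζ = ∑' z : (dBdry h B), Kker h B z ζ * f z * (sden h B z : ℂ) := by
    intro ζ hζ
    rw [(hasSum_boundary hh hB hfin f ζ).tsum_eq]
    have hterm : ∀ z ∈ hfin.toFinset,
        h / 4 * (Eh h (h - (z - ζ)) - Eh h (-h - (z - ζ)) +
          I * (Eh h (h * I - (z - ζ)) - Eh h (-(h * I) - (z - ζ)))) * f z -
        h ^ 2 * Eh h (-(z - ζ)) * dbarC h f z = if z = ζ then f ζ else 0 := by
      intro z hz
      have hzB := hfin.mem_toFinset.1 hz
      rw [hf z hzB, Eh_difference hh (hB hzB) hζ]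
      split_ifs with hzζ
      · rw [hzζ]; field_simp; ring
      · ring
    rw [Finset.sum_congr rfl hterm, Finset.sum_ite_eq']
    by_cases hζB : ζ ∈ B <;> simp [hζB]
  refine ⟨key, fun ζ hζ => ?_, fun ζ hζ => ?_⟩
  · rw [← key ζ hζ.1.1, indicator_of_mem hζ.2]
  · rw [← key ζ hζ.1.1, indicator_of_notMem hζ.2]

end
end
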